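/- (First Andrews–Berkovich ₁₀φ₉ identity) Let n be a nonnegative integer and let q, a, k be nonzero complex numbers with a ≠ 1 such that all factors appearing in denominators below are nonzero, i.e. (q;q)_n ≠ 0, (kq;q²)_n ≠ 0, (k;q²)_n ≠ 0, (a²q²/k;q)_n ≠ 0, (a q^{-n+1}/k;q)_n ≠ 0, (a q^{n+1};q)_n ≠ 0, (k;q)_n ≠ 0, and (k/a;q)_n ≠ 0. Then ∑_{j=0}^{n} ( (a;q)_j · ((1 − a q^{2j})/(1 − a)) · (a²q/k;q²)_j · (a²q²/k;q²)_j · (k/(aq);q)_j · (k q^n;q)_j · (q^{-n};q)_j / ( (q;q)_j (kq;q²)_j (k;q²)_j (a²q²/k;q)_j (a q^{-n+1}/k;q)_j (a q^{n+1};q)_j ) ) · q^j = (aq;q)_n (k²/(a²q);q)_n / ((k;q)_n (k/a;q)_n). -/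

import Mathlib

/-- The $q$-shifted factorial $(a;q)_m = \prod_{k=0}^{m-1}(1 - a q^k)$. -/
noncomputable def qPoch (q a : ℂ) (m : ℕ) : ℂ := ∏ k ∈ Finset.range m, (1 - a * q ^ k)

theorem qPoch_zero (q a : ℂ) : qPoch q a 0 = 1 := by simp [qPoch]

theorem qPoch_succ (q a : ℂ) (m : ℕ) :
    qPoch q a (m + 1) = qPoch q a m * (1 - a * q ^ m) := by
  simp [qPoch, Finset.prod_range_succ]

theorem qPoch_add (q a : ℂ) (m l : ℕ) :
    qPoch q a (m + l) = qPoch q a m * qPoch q (a * q ^ m) l := by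
  simp only [qPoch, Finset.prod_range_add, pow_add, mul_assoc]

theorem qPoch_ne_zero_of_le {q a : ℂ} {m l : ℕ} (hml : m ≤ l) (h : qPoch q a l ≠ 0) :
    qPoch q a m ≠ 0 := by
  obtain ⟨s, rfl⟩ := Nat.exists_eq_add_of_le hml
  rw [qPoch_add] at h
  exact left_ne_zero_of_mul h

theorem one_sub_mul_pow_ne_zero {q a : ℂ} {m l : ℕ} (hml : m < l) (h : qPoch q a l ≠ 0) :
    1 - a * q ^ m ≠ 0 := by
  have h' := qPoch_ne_zero_of_le (Nat.succ_le_of_lt hml) h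
  rw [Nat.succ_eq_add_one, qPoch_succ] at h'
  exact right_ne_zero_of_mul h'

theorem qPoch_two_mul (q a : ℂ) (m : ℕ) :
    qPoch q a (2 * m) = qPoch (q ^ 2) a m * qPoch (q ^ 2) (a * q) m := by
  induction m with
  | zero => simp [qPoch_zero]
  | succ m ih =>
    rw [show 2 * (m + 1) = 2 * m + 1 + 1 by ring, qPoch_succ, qPoch_succ, ih, qPoch_succ,
      qPoch_succ]
    ring

theorem qPoch_reverse {q x : ℂ} (hq : q ≠ 0) (hx : x ≠ 0) (s j : ℕ) :
    qPoch q x (s + j) = qPoch q x s * (x ^ j * ∏ i ∈ Finset.range j, -q ^ (s + i)) *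
      qPoch q (q ^ (1 - ((s + j : ℕ) : ℤ)) / x) j := by
  rw [qPoch_add, mul_assoc]
  congr 1
  rw [qPoch, qPoch, ← Finset.prod_range_reflect (fun k => 1 - _ / x * q ^ k),
    ← Finset.card_range j, ← Finset.prod_const x, Finset.card_range, ← Finset.prod_mul_distrib,
    ← Finset.prod_mul_distrib]
  refine Finset.prod_congr rfl fun i hi => ?_
  obtain ⟨l, rfl⟩ := Nat.exists_eq_add_of_lt (Finset.mem_range.mp hi)
  rw [show i + l + 1 - 1 - i = l by omega,
    show 1 - ((s + (i + l + 1) : ℕ) : ℤ) = -((s + i + l : ℕ) : ℤ) by push_cast; ring,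
    zpow_neg, zpow_natCast]
  field_simp
  ring

/-- The $q$-Pfaff–Saalschütz sum. -/
theorem qPoch_saalschutz {q A B C : ℂ} (hq : q ≠ 0) (N : ℕ) (hqN : qPoch q q N ≠ 0)
    (hD : qPoch q (A * B * C) N ≠ 0) :
    ∑ m ∈ Finset.range (N + 1), qPoch q C (N - m) * C ^ m * qPoch q A m * qPoch q B m /
        (qPoch q q (N - m) * qPoch q q m * qPoch q (A * B * C) m) =
      qPoch q (B * C) N * qPoch q (A * C) N / (qPoch q q N * qPoch q (A * B * C) N) := by
  induction N with
  | zero => simp [qPoch_zero]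
  | succ N ih =>
    have hqN' := qPoch_ne_zero_of_le N.le_succ hqN
    have hD' := qPoch_ne_zero_of_le N.le_succ hD
    specialize ih hqN' hD'
    have hu := one_sub_mul_pow_ne_zero N.lt_succ_self hqN
    have hv := one_sub_mul_pow_ne_zero N.lt_succ_self hD
    let G : ℕ → ℂ := fun m => -q ^ (N + 1 - m) * qPoch q C (N + 1 - m) * C ^ m * qPoch q A m *
      qPoch q B m * (1 - q ^ m) * (1 - A * B * C * q ^ m / q) /
        (qPoch q q (N + 1 - m) * qPoch q q m * qPoch q (A * B * C) m)
    have step : ∀ m ∈ Finset.range (N + 1),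
        (1 - q * q ^ N) * (1 - A * B * C * q ^ N) *
          (qPoch q C (N + 1 - m) * C ^ m * qPoch q A m * qPoch q B m /
            (qPoch q q (N + 1 - m) * qPoch q q m * qPoch q (A * B * C) m)) -
        (1 - B * C * q ^ N) * (1 - A * C * q ^ N) *
          (qPoch q C (N - m) * C ^ m * qPoch q A m * qPoch q B m /
            (qPoch q q (N - m) * qPoch q q m * qPoch q (A * B * C) m)) = G (m + 1) - G m := by
      intro m hm
      obtain ⟨s, rfl⟩ := Nat.exists_eq_add_of_le (Finset.mem_range_succ_iff.mp hm)
      have e1 : m + s + 1 - m = s + 1 := by omega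
      have e2 : m + s + 1 - (m + 1) = s := by omega
      have e3 : m + s - m = s := by omega
      simp only [G, e1, e2, e3, qPoch_succ]
      have n1 : qPoch q q s ≠ 0 := qPoch_ne_zero_of_le (by omega) hqN
      have n2 : qPoch q q m ≠ 0 := qPoch_ne_zero_of_le (by omega) hqN
      have n3 : qPoch q (A * B * C) m ≠ 0 := qPoch_ne_zero_of_le (by omega) hD
      have n4 : 1 - q * q ^ s ≠ 0 := one_sub_mul_pow_ne_zero (by omega) hqN
      have n5 : 1 - q * q ^ m ≠ 0 := one_sub_mul_pow_ne_zero (by omega) hqN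
      have n6 : 1 - A * B * C * q ^ m ≠ 0 := one_sub_mul_pow_ne_zero (by omega) hD
      rw [pow_succ q m, pow_add q m s, pow_succ C m, pow_succ q s]
      generalize q ^ m = x at *
      generalize q ^ s = y at *
      generalize qPoch q (A * B * C) m = z1 at *
      generalize qPoch q q m = z2 at *
      generalize qPoch q q s = z3 at *
      rw [mul_comm x q]
      generalize hu1 : 1 - q * y = u1 at n4 ⊢
      generalize hu2 : 1 - q * x = u2 at n5 ⊢
      generalize hu3 : 1 - A * B * C * x = u3 at n6 ⊢
      field_simp
      subst hu1 hu2 hu3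
      ring
    have tel := Finset.sum_congr rfl step
    rw [Finset.sum_range_sub, Finset.sum_sub_distrib, ← Finset.mul_sum, ← Finset.mul_sum, ih] at tel
    have hG0 : G 0 = 0 := by simp [G]
    have hG : G (N + 1) = -((1 - q * q ^ N) * (1 - A * B * C * q ^ N) *
        (C ^ (N + 1) * qPoch q A (N + 1) * qPoch q B (N + 1) /
          (qPoch q q (N + 1) * qPoch q (A * B * C) (N + 1)))) := by
      simp only [G, Nat.sub_self, qPoch_zero, pow_succ]
      field_simp
    rw [Finset.sum_range_succ, Nat.sub_self, qPoch_zero, qPoch_zero, one_mul, one_mul]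
    rw [hG0, hG] at tel
    apply mul_left_cancel₀ (mul_ne_zero hu hv)
    rw [mul_add]
    have hr : (1 - q * q ^ N) * (1 - A * B * C * q ^ N) * (qPoch q (B * C) (N + 1) *
        qPoch q (A * C) (N + 1) / (qPoch q q (N + 1) * qPoch q (A * B * C) (N + 1))) =
        (1 - B * C * q ^ N) * (1 - A * C * q ^ N) * (qPoch q (B * C) N * qPoch q (A * C) N /
          (qPoch q q N * qPoch q (A * B * C) N)) := by
      simp only [qPoch_succ]
      generalize 1 - A * B * C * q ^ N = u at hv ⊢
      field_simp
    rw [hr]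
    linear_combination tel

/-- The terms of the unit WP-Bailey pair satisfy the defining orthogonality relation. -/
theorem sum_unit_wp_bailey_pair {q a κ : ℂ} (ha : a ≠ 0) (hκ : κ ≠ 0) (hκa : κ ≠ a)
    (r : ℕ) (hr : r ≠ 0) (hqr : qPoch q q r ≠ 0) (haq : qPoch q (a * q) (2 * r) ≠ 0)
    (hκq : qPoch q (κ * q) r ≠ 0) :
    ∑ j ∈ Finset.range (r + 1), qPoch q (κ / a) (r - j) * qPoch q κ (r + j) /
        (qPoch q q (r - j) * qPoch q (a * q) (r + j)) *
      (qPoch q a j * (1 - a * q ^ (2 * j)) * qPoch q (a / κ) j /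
        (qPoch q q j * qPoch q (κ * q) j) * (κ / a) ^ j) = 0 := by
  let H : ℕ → ℂ := fun j =>
    (1 - κ / a * q ^ (r - j)) * (1 - a * q ^ (r + j)) * (1 - q ^ j) * (1 - κ * q ^ j) *
    (qPoch q (κ / a) (r - j) * qPoch q κ (r + j) /
        (qPoch q q (r - j) * qPoch q (a * q) (r + j)) *
      (qPoch q a j * qPoch q (a / κ) j /
        (qPoch q q j * qPoch q (κ * q) j) * (κ / a) ^ j))
  obtain ⟨p, rfl⟩ := Nat.exists_eq_succ_of_ne_zero hr
  have hc : (κ / a - 1) * (1 - q * q ^ p) * (1 - κ * q * q ^ p) ≠ 0 :=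
    mul_ne_zero (mul_ne_zero (by rw [Ne, sub_eq_zero, div_eq_one_iff_eq ha]; exact hκa)
      (one_sub_mul_pow_ne_zero p.lt_succ_self hqr)) (one_sub_mul_pow_ne_zero p.lt_succ_self hκq)
  apply mul_left_cancel₀ hc
  rw [mul_zero, Finset.mul_sum, Finset.sum_range_succ]
  have step : ∀ j ∈ Finset.range p.succ, (κ / a - 1) * (1 - q * q ^ p) * (1 - κ * q * q ^ p) *
      (qPoch q (κ / a) (p.succ - j) * qPoch q κ (p.succ + j) /
        (qPoch q q (p.succ - j) * qPoch q (a * q) (p.succ + j)) *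
      (qPoch q a j * (1 - a * q ^ (2 * j)) * qPoch q (a / κ) j /
        (qPoch q q j * qPoch q (κ * q) j) * (κ / a) ^ j)) = H (j + 1) - H j := by
    intro j hj
    obtain ⟨s, rfl⟩ := Nat.exists_eq_add_of_le (Nat.lt_succ_iff.mp (Finset.mem_range.mp hj))
    have e1 : (j + s).succ - j = s + 1 := by omega
    have e2 : (j + s).succ - (j + 1) = s := by omega
    have e3 : (j + s).succ + (j + 1) = (2 * j + s + 1) + 1 := by omega
    have e4 : (j + s).succ + j = 2 * j + s + 1 := by omega
    have n1 : qPoch q q s ≠ 0 := qPoch_ne_zero_of_le (by omega) hqr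
    have n2 : qPoch q q j ≠ 0 := qPoch_ne_zero_of_le (by omega) hqr
    have n3 : qPoch q (κ * q) j ≠ 0 := qPoch_ne_zero_of_le (by omega) hκq
    have n4 : qPoch q (a * q) (2 * j + s + 1) ≠ 0 := qPoch_ne_zero_of_le (by omega) haq
    have n5 : 1 - q * q ^ s ≠ 0 := one_sub_mul_pow_ne_zero (by omega) hqr
    have n6 : 1 - q * q ^ j ≠ 0 := one_sub_mul_pow_ne_zero (by omega) hqr
    have n7 : 1 - κ * q * q ^ j ≠ 0 := one_sub_mul_pow_ne_zero (by omega) hκq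
    have n8 : 1 - a * q * q ^ (2 * j + s + 1) ≠ 0 := one_sub_mul_pow_ne_zero (by omega) haq
    simp only [H, e1, e2, e3, e4]
    rw [qPoch_succ q (κ / a), qPoch_succ q κ (2 * j + s + 1), qPoch_succ q q, qPoch_succ q q,
      qPoch_succ q (a * q) (2 * j + s + 1), qPoch_succ q a, qPoch_succ q (a / κ),
      qPoch_succ q (κ * q)]
    have p1 : q ^ (2 * j + s + 1) = q ^ j * q ^ j * q ^ s * q := by ring
    have p2 : q ^ (2 * j) = q ^ j * q ^ j := by ring
    have p3 : q ^ (j + s) = q ^ j * q ^ s := by ring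
    rw [pow_succ q (2 * j + s + 1), pow_succ (κ / a) j, pow_succ q s, pow_succ q j]
    rw [p1] at n8 ⊢
    rw [p2, p3]
    generalize q ^ j = x at *
    generalize q ^ s = y at *
    generalize (κ / a) ^ j = w
    generalize qPoch q (a * q) (2 * j + s + 1) = z1 at *
    generalize qPoch q (κ * q) j = z2 at *
    generalize qPoch q q j = z3 at *
    generalize qPoch q q s = z4 at *
    generalize qPoch q κ (2 * j + s + 1) = z5 at *
    generalize qPoch q (κ / a) s = z6 at *
    generalize qPoch q (a / κ) j = z7 at *
    generalize qPoch q a j = z8 at *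
    rw [mul_comm x q]
    generalize hu1 : 1 - q * y = u1 at n5 ⊢
    generalize hu2 : 1 - q * x = u2 at n6 ⊢
    generalize hu3 : 1 - κ * q * x = u3 at n7 ⊢
    generalize hu4 : 1 - a * q * (x * x * y * q) = u4 at n8 ⊢
    field_simp
    subst hu1 hu2 hu3 hu4
    ring
  rw [Finset.sum_congr rfl step, Finset.sum_range_sub]
  have hH0 : H 0 = 0 := by simp [H]
  rw [hH0, sub_zero]
  simp only [H, Nat.sub_self, pow_zero, two_mul, pow_add, pow_succ]
  ring

theorem sum_wp_bailey_weight {q a k : ℂ} (hq : q ≠ 0) (ha : a ≠ 0) (hk : k ≠ 0) {j n : ℕ}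
    (hj : j ≤ n) (hqn : qPoch q q n ≠ 0) (haq : qPoch q (a * q) (2 * n) ≠ 0)
    (hk2 : qPoch q k (2 * n) ≠ 0) :
    ∑ m ∈ Finset.range (n - j + 1),
      qPoch q (k ^ 2 / (a ^ 2 * q)) (n - (j + m)) / qPoch q q (n - (j + m)) *
        (k ^ 2 / (a ^ 2 * q)) ^ (j + m) *
        (qPoch q (a ^ 2 * q / k / a) m * qPoch q (a ^ 2 * q / k) (2 * j + m) /
          (qPoch q q m * qPoch q (a * q) (2 * j + m))) =
      (k ^ 2 / (a ^ 2 * q)) ^ j * qPoch q (a ^ 2 * q / k) (2 * j) * qPoch q k (n + j) *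
        qPoch q (k / a) (n - j) /
        (qPoch q k (2 * j) * qPoch q q (n - j) * qPoch q (a * q) (n + j)) := by
  obtain ⟨s, rfl⟩ := Nat.exists_eq_add_of_le hj
  have hABC : a ^ 2 * q / k / a * (a ^ 2 * q / k * q ^ (2 * j)) * (k ^ 2 / (a ^ 2 * q)) =
      a * q * q ^ (2 * j) := by field_simp
  have hBC : a ^ 2 * q / k * q ^ (2 * j) * (k ^ 2 / (a ^ 2 * q)) = k * q ^ (2 * j) := by field_simp
  have hAC : a ^ 2 * q / k / a * (k ^ 2 / (a ^ 2 * q)) = k / a := by field_simp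
  have hsplit : qPoch q (a * q) (2 * j + s) ≠ 0 := qPoch_ne_zero_of_le (by omega) haq
  have hk2j : qPoch q k (2 * j) ≠ 0 := qPoch_ne_zero_of_le (by omega) hk2
  have hqs : qPoch q q s ≠ 0 := qPoch_ne_zero_of_le (by omega) hqn
  rw [qPoch_add] at hsplit
  obtain ⟨h2j, hD⟩ := mul_ne_zero_iff.mp hsplit
  have S := qPoch_saalschutz (A := a ^ 2 * q / k / a) (B := a ^ 2 * q / k * q ^ (2 * j))
    (C := k ^ 2 / (a ^ 2 * q)) hq s hqs (by rwa [hABC])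
  rw [hABC, hBC, hAC] at S
  have e1 : j + s - j = s := by omega
  have e2 : j + s + j = 2 * j + s := by omega
  rw [e1, e2, qPoch_add q k, qPoch_add q (a * q)]
  trans (k ^ 2 / (a ^ 2 * q)) ^ j * qPoch q (a ^ 2 * q / k) (2 * j) / qPoch q (a * q) (2 * j) *
    (qPoch q (k * q ^ (2 * j)) s * qPoch q (k / a) s /
      (qPoch q q s * qPoch q (a * q * q ^ (2 * j)) s))
  · rw [← S, Finset.mul_sum]
    refine Finset.sum_congr rfl fun m hm => ?_
    rw [show j + s - (j + m) = s - m by omega, qPoch_add q _ (2 * j) m, qPoch_add q _ (2 * j) m,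
      pow_add]
    simp only [div_eq_mul_inv, mul_inv]
    ring
  · field_simp

theorem andrews_berkovich_first_of_generic {n : ℕ} {q a k : ℂ}
    (hq : q ≠ 0) (ha : a ≠ 0) (hk : k ≠ 0) (ha1 : a ≠ 1)
    (h1 : qPoch q q n ≠ 0) (h2 : qPoch (q ^ 2) (k * q) n ≠ 0)
    (h3 : qPoch (q ^ 2) k n ≠ 0) (h4 : qPoch q (a ^ 2 * q ^ 2 / k) n ≠ 0)
    (h7 : qPoch q k n ≠ 0) (h8 : qPoch q (k / a) n ≠ 0)
    (haq : qPoch q (a * q) (2 * n) ≠ 0) (hka : a * q ≠ k) :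
    ∑ j ∈ Finset.range (n + 1),
      qPoch q a j * ((1 - a * q ^ (2 * j)) / (1 - a)) * qPoch (q ^ 2) (a ^ 2 * q / k) j *
        qPoch (q ^ 2) (a ^ 2 * q ^ 2 / k) j * qPoch q (k / (a * q)) j *
        qPoch q (k * q ^ n) j * qPoch q (q ^ (-(n : ℤ))) j /
        (qPoch q q j * qPoch (q ^ 2) (k * q) j * qPoch (q ^ 2) k j *
          qPoch q (a ^ 2 * q ^ 2 / k) j * qPoch q (a * q ^ (1 - (n : ℤ)) / k) j *
          qPoch q (a * q ^ (n + 1)) j) * q ^ j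
    = qPoch q (a * q) n * qPoch q (k ^ 2 / (a ^ 2 * q)) n /
        (qPoch q k n * qPoch q (k / a) n) := by
  have hk2 : qPoch q k (2 * n) ≠ 0 := by
    rw [qPoch_two_mul]
    exact mul_ne_zero h3 h2
  have hκq : a ^ 2 * q / k * q = a ^ 2 * q ^ 2 / k := by ring
  have haκ : a / (a ^ 2 * q / k) = k / (a * q) := by field_simp
  have hκa : a ^ 2 * q / k ≠ a := by
    intro h
    apply hka
    field_simp at h
    exact h
  have h1a : 1 - a ≠ 0 := sub_ne_zero.mpr ha1.symm
  let α : ℕ → ℂ := fun j => qPoch q a j * (1 - a * q ^ (2 * j)) *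
    qPoch q (a / (a ^ 2 * q / k)) j / (qPoch q q j * qPoch q (a ^ 2 * q / k * q) j) *
      (a ^ 2 * q / k / a) ^ j
  have pair : ∀ r ∈ Finset.range (n + 1), r ≠ 0 → ∑ j ∈ Finset.range (r + 1),
      qPoch q (a ^ 2 * q / k / a) (r - j) * qPoch q (a ^ 2 * q / k) (r + j) /
        (qPoch q q (r - j) * qPoch q (a * q) (r + j)) * α j = 0 := by
    intro r hr hr0
    have hrn := Finset.mem_range_succ_iff.mp hr
    exact sum_unit_wp_bailey_pair ha (by positivity) hκa r hr0
      (qPoch_ne_zero_of_le hrn h1) (qPoch_ne_zero_of_le (by omega) haq)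
      (qPoch_ne_zero_of_le hrn (by rwa [hκq]))
  have key : ∑ j ∈ Finset.range (n + 1), (k ^ 2 / (a ^ 2 * q)) ^ j *
        qPoch q (a ^ 2 * q / k) (2 * j) * qPoch q k (n + j) * qPoch q (k / a) (n - j) /
        (qPoch q k (2 * j) * qPoch q q (n - j) * qPoch q (a * q) (n + j)) * α j =
      (1 - a) * (qPoch q (k ^ 2 / (a ^ 2 * q)) n / qPoch q q n) := by
    trans ∑ r ∈ Finset.range (n + 1), qPoch q (k ^ 2 / (a ^ 2 * q)) (n - r) / qPoch q q (n - r) *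
        (k ^ 2 / (a ^ 2 * q)) ^ r * ∑ j ∈ Finset.range (r + 1),
          qPoch q (a ^ 2 * q / k / a) (r - j) * qPoch q (a ^ 2 * q / k) (r + j) /
            (qPoch q q (r - j) * qPoch q (a * q) (r + j)) * α j
    · simp only [Finset.mul_sum]
      rw [Finset.sum_comm' (t' := Finset.range (n + 1)) (s' := fun j => Finset.Ico j (n + 1))
        (by intro x y; simp only [Finset.mem_range, Finset.mem_Ico]; omega)]
      refine Finset.sum_congr rfl fun j hj => ?_
      have hjn := Finset.mem_range_succ_iff.mp hj
      rw [← sum_wp_bailey_weight hq ha hk hjn h1 haq hk2, Finset.sum_mul,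
        Finset.sum_Ico_eq_sum_range, show n + 1 - j = n - j + 1 by omega]
      refine Finset.sum_congr rfl fun m _ => ?_
      rw [show j + m - j = m by omega, show j + m + j = 2 * j + m by omega]
      ring
    · rw [Finset.sum_eq_single 0]
      · simp [α, qPoch_zero]
        ring
      · intro r hr hr0
        rw [pair r hr hr0, mul_zero]
      · simp
  trans (∑ j ∈ Finset.range (n + 1), (k ^ 2 / (a ^ 2 * q)) ^ j *
        qPoch q (a ^ 2 * q / k) (2 * j) * qPoch q k (n + j) * qPoch q (k / a) (n - j) /
        (qPoch q k (2 * j) * qPoch q q (n - j) * qPoch q (a * q) (n + j)) * α j) *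
      (qPoch q q n * qPoch q (a * q) n / ((1 - a) * qPoch q k n * qPoch q (k / a) n))
  · rw [Finset.sum_mul]
    refine Finset.sum_congr rfl fun j hj => ?_
    obtain ⟨s, rfl⟩ := Nat.exists_eq_add_of_le' (Finset.mem_range_succ_iff.mp hj)
    have rq := qPoch_reverse hq hq s j
    have rk := qPoch_reverse hq (div_ne_zero hk ha) s j
    have z1 : q ^ (1 - ((s + j : ℕ) : ℤ)) / q = q ^ (-((s + j : ℕ) : ℤ)) := by
      rw [zpow_sub₀ hq, zpow_neg, zpow_one]
      field_simp
    have z2 : q ^ (1 - ((s + j : ℕ) : ℤ)) / (k / a) = a * q ^ (1 - ((s + j : ℕ) : ℤ)) / k := by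
      field_simp
    rw [z1] at rq
    rw [z2] at rk
    have hpow : (k ^ 2 / (a ^ 2 * q)) ^ j * (a ^ 2 * q / k / a) ^ j = (k / a) ^ j := by
      rw [← mul_pow]
      congr 1
      field_simp
    have haqj : qPoch q (a * q) (s + j + j) ≠ 0 := qPoch_ne_zero_of_le (by omega) haq
    have hkj : qPoch q k (2 * j) ≠ 0 := qPoch_ne_zero_of_le (by omega) hk2
    have hqj := qPoch_ne_zero_of_le (Nat.le_add_left j s) h1
    have h4j := qPoch_ne_zero_of_le (Nat.le_add_left j s) h4
    have aq : a * q * q ^ (s + j) = a * q ^ (s + j + 1) := by ring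
    rw [qPoch_two_mul] at hkj
    rw [qPoch_add, aq] at haqj
    simp only [α]
    rw [haκ, hκq, qPoch_two_mul, qPoch_two_mul, qPoch_add q k, qPoch_add q (a * q), aq, hκq,
      Nat.add_sub_cancel]
    rw [rq] at h1
    rw [rk] at h8
    rw [rq, rk]
    simp only [mul_ne_zero_iff] at hkj haqj h1 h8
    obtain ⟨hkj1, hkj2⟩ := hkj
    obtain ⟨haq1, haq2⟩ := haqj
    obtain ⟨⟨hqs, -, hR⟩, -⟩ := h1
    obtain ⟨⟨hks, hkaj, -⟩, hrev⟩ := h8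
    generalize (∏ i ∈ Finset.range j, -q ^ (s + i)) = R at *
    trans (qPoch q a j * (1 - a * q ^ (2 * j)) * qPoch (q ^ 2) (a ^ 2 * q / k) j *
        qPoch (q ^ 2) (a ^ 2 * q ^ 2 / k) j * qPoch q (k / (a * q)) j *
        qPoch q (k * q ^ (s + j)) j * qPoch q (q ^ (-((s + j : ℕ) : ℤ))) j /
        (qPoch q q j * qPoch (q ^ 2) (k * q) j * qPoch (q ^ 2) k j *
          qPoch q (a ^ 2 * q ^ 2 / k) j * qPoch q (a * q ^ (1 - ((s + j : ℕ) : ℤ)) / k) j *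
          qPoch q (a * q ^ (s + j + 1)) j) * q ^ j) / (1 - a) *
        (((k ^ 2 / (a ^ 2 * q)) ^ j * (a ^ 2 * q / k / a) ^ j) / (k / a) ^ j)
    · rw [hpow, div_self hkaj]
      ring
    · generalize (k ^ 2 / (a ^ 2 * q)) ^ j = w1
      generalize (a ^ 2 * q / k / a) ^ j = w2
      generalize (k / a) ^ j = w3 at *
      generalize qPoch q (k / a) s = x1 at *
      generalize qPoch q (k / (a * q)) j = x2 at *
      generalize qPoch q (a ^ 2 * q ^ 2 / k) j = x3 at *
      generalize qPoch (q ^ 2) (a ^ 2 * q ^ 2 / k) j = x4 at *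
      generalize qPoch (q ^ 2) (a ^ 2 * q / k) j = x5 at *
      generalize qPoch q (a * q ^ (1 - ((s + j : ℕ) : ℤ)) / k) j = x6 at *
      generalize qPoch q (q ^ (-((s + j : ℕ) : ℤ))) j = x7 at *
      generalize 1 - a = u at *
      field_simp
  · rw [key]
    field_simp

theorem continuous_qPoch (q : ℂ) (m : ℕ) : Continuous fun a => qPoch q a m := by
  unfold qPoch
  fun_prop

theorem eventually_ne_punctured_nhds {X : Type*} [TopologicalSpace X] [T1Space X] (x c : X) :
    ∀ᶠ y in nhdsWithin x {x}ᶜ, y ≠ c := by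
  by_cases h : x = c
  · subst h
    exact self_mem_nhdsWithin
  · exact eventually_ne_nhdsWithin h

theorem eventually_qPoch_mul_ne_zero {q : ℂ} (hq : q ≠ 0) (m : ℕ) (a₀ : ℂ) :
    ∀ᶠ a in nhdsWithin a₀ {a₀}ᶜ, qPoch q (a * q) m ≠ 0 := by
  simp only [qPoch, Finset.prod_ne_zero_iff]
  rw [Filter.eventually_all_finset]
  intro i _
  filter_upwards [eventually_ne_punctured_nhds a₀ (q * q ^ i)⁻¹] with a ha h0
  apply ha
  have : q ^ i ≠ 0 := pow_ne_zero _ hq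
  field_simp
  linear_combination -h0

/-- First Andrews–Berkovich ${}_{10}\phi_9$ identity (root-free form). -/
theorem andrews_berkovich_first (n : ℕ) (q a k : ℂ)
    (hq : q ≠ 0) (ha : a ≠ 0) (hk : k ≠ 0) (ha1 : a ≠ 1)
    (h1 : qPoch q q n ≠ 0) (h2 : qPoch (q ^ 2) (k * q) n ≠ 0)
    (h3 : qPoch (q ^ 2) k n ≠ 0) (h4 : qPoch q (a ^ 2 * q ^ 2 / k) n ≠ 0)
    (h5 : qPoch q (a * q ^ (1 - (n : ℤ)) / k) n ≠ 0)
    (h6 : qPoch q (a * q ^ (n + 1)) n ≠ 0)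
    (h7 : qPoch q k n ≠ 0) (h8 : qPoch q (k / a) n ≠ 0) :
    ∑ j ∈ Finset.range (n + 1),
      qPoch q a j * ((1 - a * q ^ (2 * j)) / (1 - a)) * qPoch (q ^ 2) (a ^ 2 * q / k) j *
        qPoch (q ^ 2) (a ^ 2 * q ^ 2 / k) j * qPoch q (k / (a * q)) j *
        qPoch q (k * q ^ n) j * qPoch q (q ^ (-(n : ℤ))) j /
        (qPoch q q j * qPoch (q ^ 2) (k * q) j * qPoch (q ^ 2) k j *
          qPoch q (a ^ 2 * q ^ 2 / k) j * qPoch q (a * q ^ (1 - (n : ℤ)) / k) j *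
          qPoch q (a * q ^ (n + 1)) j) * q ^ j
    = qPoch q (a * q) n * qPoch q (k ^ 2 / (a ^ 2 * q)) n /
        (qPoch q k n * qPoch q (k / a) n) := by
  have h1a : 1 - a ≠ 0 := sub_ne_zero.mpr ha1.symm
  have haq : a * q ≠ 0 := mul_ne_zero ha hq
  have haq2 : a ^ 2 * q ≠ 0 := mul_ne_zero (pow_ne_zero 2 ha) hq
  have comp : ∀ (p : ℂ) (f : ℂ → ℂ) (m : ℕ), ContinuousAt f a →
      ContinuousAt (fun b => qPoch p (f b) m) a := fun p f m hf =>
    ContinuousAt.comp (f := f) (continuous_qPoch p m).continuousAt hf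
  have hid : ContinuousAt (fun b : ℂ => b) a := continuousAt_id
  have c4 : ContinuousAt (fun b => b ^ 2 * q ^ 2 / k) a := by fun_prop
  have c8 : ContinuousAt (fun b => k / b) a := continuousAt_const.div hid ha
  have hL : ContinuousAt (fun b => ∑ j ∈ Finset.range (n + 1),
      qPoch q b j * ((1 - b * q ^ (2 * j)) / (1 - b)) * qPoch (q ^ 2) (b ^ 2 * q / k) j *
        qPoch (q ^ 2) (b ^ 2 * q ^ 2 / k) j * qPoch q (k / (b * q)) j *
        qPoch q (k * q ^ n) j * qPoch q (q ^ (-(n : ℤ))) j /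
        (qPoch q q j * qPoch (q ^ 2) (k * q) j * qPoch (q ^ 2) k j *
          qPoch q (b ^ 2 * q ^ 2 / k) j * qPoch q (b * q ^ (1 - (n : ℤ)) / k) j *
          qPoch q (b * q ^ (n + 1)) j) * q ^ j) a := by
    refine tendsto_finsetSum _ fun j hj => ?_
    have hjn := Finset.mem_range_succ_iff.mp hj
    have d0 := comp q _ j hid
    have d1 : ContinuousAt (fun b => (1 - b * q ^ (2 * j)) / (1 - b)) a :=
      ContinuousAt.div (by fun_prop) (by fun_prop) h1a
    have d2 := comp (q ^ 2) (fun b => b ^ 2 * q / k) j (by fun_prop)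
    have d3 := comp (q ^ 2) _ j c4
    have d4 := comp q (fun b => k / (b * q)) j
      (ContinuousAt.div (by fun_prop) (by fun_prop) haq)
    have d5 := comp q _ j c4
    have d6 := comp q (fun b => b * q ^ (1 - (n : ℤ)) / k) j (by fun_prop)
    have d7 := comp q (fun b => b * q ^ (n + 1)) j (by fun_prop)
    exact (ContinuousAt.div (((((((d0.mul d1).mul d2).mul d3).mul d4).mul continuousAt_const).mul
      continuousAt_const)) (((continuousAt_const.mul d5).mul d6).mul d7)
      (mul_ne_zero (mul_ne_zero (mul_ne_zero (mul_ne_zero (mul_ne_zero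
        (qPoch_ne_zero_of_le hjn h1) (qPoch_ne_zero_of_le hjn h2)) (qPoch_ne_zero_of_le hjn h3))
        (qPoch_ne_zero_of_le hjn h4)) (qPoch_ne_zero_of_le hjn h5))
        (qPoch_ne_zero_of_le hjn h6))).mul continuousAt_const
  have hR : ContinuousAt (fun b => qPoch q (b * q) n * qPoch q (k ^ 2 / (b ^ 2 * q)) n /
        (qPoch q k n * qPoch q (k / b) n)) a :=
    ContinuousAt.div ((comp q (fun b => b * q) n (by fun_prop)).mul
      (comp q (fun b => k ^ 2 / (b ^ 2 * q)) n
        (ContinuousAt.div (by fun_prop) (by fun_prop) haq2)))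
      (continuousAt_const.mul (comp q _ n c8)) (mul_ne_zero h7 h8)
  have hle : nhdsWithin a {a}ᶜ ≤ nhds a := nhdsWithin_le_nhds
  refine tendsto_nhds_unique_of_eventuallyEq (hL.mono_left hle) (hR.mono_left hle) ?_
  filter_upwards [hle (hid.eventually_ne ha), hle (hid.eventually_ne ha1),
    hle ((comp q _ n c4).eventually_ne h4), hle ((comp q _ n c8).eventually_ne h8),
    eventually_qPoch_mul_ne_zero hq (2 * n) a, eventually_ne_punctured_nhds a (k / q)]
    with b hb hb1 hb4 hb8 hbq hbk
  exact andrews_berkovich_first_of_generic hq hb hk hb1 h1 h2 h3 hb4 h7 hb8 hbq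
    fun h => hbk (eq_div_of_mul_eq hq h)
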